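/- Let $a$ be a positive integer and let $f : \mathbb{N} \to \mathbb{R}$ satisfy $f(n) > 0$ for all $n$ and $f(n) = o(n^{-3/2})$. For each $n$ set $r_n = \frac{1}{2n} + \frac{f(n)}{2}$, and define $E^{(a)}(r_n)$ as the infimum, over all sequences $0 \le b_1 \le \dots \le b_n \le 1$ with $b_1 \le r_n$, $1 - b_n \le r_n$, and $b_{i+1} - b_i \le 2 r_n$ for all $i$, of $\sum_{i=1}^{n} \mathbb{E}|X_{(i)} - b_i|^a$, where $X_{(i)}$ is the $i$-th order statistic of $n$ i.i.d. uniform points on $[0,1]$. Then $E^{(a)}(r_n) = \Theta(n^{1-a/2})$; that is, there exist constants $c_2 \ge c_1 > 0$ and $N$ such that for all $n \ge N$, $c_1 n^{1-a/2} \le E^{(a)}(r_n) \le c_2 n^{1-a/2}$. -/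

import Mathlib

/-- A configuration `b₁, …, bₙ` of sensor positions covers `[0,1]` with radius `r`:
`0 ≤ b₁ ≤ ⋯ ≤ bₙ ≤ 1`, `b₁ ≤ r`, `1 - bₙ ≤ r`, and consecutive gaps at most `2r`. -/
def Covers (n : ℕ) (r : ℝ) (b : ℕ → ℝ) : Prop :=
  0 ≤ b 1 ∧ b n ≤ 1 ∧ (∀ i ∈ Finset.Icc 1 (n - 1), b i ≤ b (i + 1)) ∧
  b 1 ≤ r ∧ 1 - b n ≤ r ∧ (∀ i ∈ Finset.Icc 1 (n - 1), b (i + 1) - b i ≤ 2 * r)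

/-- The expected sum of `a`-th powers of distances of the order statistics of `n` i.i.d.
uniform points on `[0,1]` to target positions `b i`. -/
noncomputable def expCost (a n : ℕ) (b : ℕ → ℝ) : ℝ :=
  ∑ i ∈ Finset.Icc 1 n, (i : ℝ) * (n.choose i : ℝ) *
    ∫ x in (0:ℝ)..1, |x - b i| ^ a * x ^ (i - 1) * (1 - x) ^ (n - i)

/-- unnormalised Beta integral -/
noncomputable def bJ (p q : ℕ) (g : ℝ → ℝ) : ℝ :=
  ∫ x in (0:ℝ)..1, g x * x ^ p * (1 - x) ^ q

/-- Beta expectation -/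
noncomputable def bE (p q : ℕ) (g : ℝ → ℝ) : ℝ :=
  ((p : ℝ) + 1) * ((p + q + 1).choose (p + 1) : ℝ) * bJ p q g

lemma bJ_ibp (p q : ℕ) :
    ((p : ℝ) + 1) * bJ p (q + 1) (fun _ => 1) = ((q : ℝ) + 1) * bJ (p + 1) q (fun _ => 1) := by
  have h : ∫ x in (0:ℝ)..1, (((p:ℝ) + 1) * (1 * x ^ p * (1 - x) ^ (q + 1))
      - ((q:ℝ) + 1) * (1 * x ^ (p + 1) * (1 - x) ^ q))
      = (1:ℝ) ^ (p + 1) * (1 - 1) ^ (q + 1) - (0:ℝ) ^ (p + 1) * (1 - 0) ^ (q + 1) := by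
    apply intervalIntegral.integral_eq_sub_of_hasDerivAt
      (f := fun x : ℝ => x ^ (p + 1) * (1 - x) ^ (q + 1))
    · intro x _
      have h1 := (hasDerivAt_id x).pow (p + 1)
      have h2 := ((hasDerivAt_id x).const_sub 1).pow (q + 1)
      have h3 := h1.mul h2
      refine h3.congr_deriv ?_
      simp only [Pi.mul_apply, Pi.pow_apply, id, Nat.add_sub_cancel]
      push_cast
      ring
    · apply Continuous.intervalIntegrable
      fun_prop
  rw [intervalIntegral.integral_sub (by apply Continuous.intervalIntegrable; fun_prop)
    (by apply Continuous.intervalIntegrable; fun_prop),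
    intervalIntegral.integral_const_mul, intervalIntegral.integral_const_mul] at h
  unfold bJ
  simp at h ⊢
  linarith

lemma bE_one (q : ℕ) : ∀ p : ℕ, bE p q (fun _ => 1) = 1 := by
  induction q with
  | zero =>
    intro p
    unfold bE bJ
    simp
    field_simp
  | succ q ih =>
    intro p
    have h1 := ih (p + 1)
    have h2 := bJ_ibp p q
    unfold bE at *
    have h3 := Nat.choose_succ_right_eq (p + q + 2) (p + 1)
    have h4 : p + q + 2 - (p + 1) = q + 1 := by omega
    rw [h4] at h3
    have h3' : ((p + q + 2).choose (p + 1 + 1) : ℝ) * ((p:ℝ) + 1 + 1)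
      = ((p + q + 2).choose (p + 1) : ℝ) * ((q : ℝ) + 1) := by exact_mod_cast h3
    have e1 : p + 1 + q + 1 = p + q + 2 := by ring
    have e2 : p + (q + 1) + 1 = p + q + 2 := by ring
    rw [e1] at h1
    rw [e2]
    push_cast at h1
    refine Eq.trans ?_ h1
    calc _ = ((p + q + 2).choose (p + 1) : ℝ) * (((p : ℝ) + 1) * bJ p (q + 1) (fun _ => 1)) := by
          generalize bJ p (q + 1) (fun _ => 1) = u
          ring
      _ = (((p + q + 2).choose (p + 1) : ℝ) * ((q : ℝ) + 1)) * bJ (p + 1) q (fun _ => 1) := by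
        rw [h2]; ring
      _ = _ := by rw [← h3']; ring

lemma bJ_int (p q : ℕ) (g : ℝ → ℝ) (hg : Continuous g) :
    IntervalIntegrable (fun x => g x * x ^ p * (1 - x) ^ q) MeasureTheory.volume 0 1 := by
  apply Continuous.intervalIntegrable; fun_prop

lemma bE_add (p q : ℕ) (g h : ℝ → ℝ) (hg : Continuous g) (hh : Continuous h) :
    bE p q (fun x => g x + h x) = bE p q g + bE p q h := by
  unfold bE bJ
  rw [← mul_add, ← intervalIntegral.integral_add (bJ_int p q g hg) (bJ_int p q h hh)]
  congr 2
  ext x; ring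

lemma bE_smul (p q : ℕ) (c : ℝ) (g : ℝ → ℝ) :
    bE p q (fun x => c * g x) = c * bE p q g := by
  unfold bE bJ
  rw [mul_left_comm c, ← intervalIntegral.integral_const_mul c]
  congr 1
  apply intervalIntegral.integral_congr
  intro x _
  simp only []
  ring

lemma bE_const (p q : ℕ) (c : ℝ) : bE p q (fun _ => c) = c := by
  have := bE_smul p q c (fun _ => 1)
  rw [bE_one] at this
  simpa using this

lemma bE_mono (p q : ℕ) (g h : ℝ → ℝ) (hg : Continuous g) (hh : Continuous h)
    (hgh : ∀ x, 0 ≤ x → x ≤ 1 → g x ≤ h x) : bE p q g ≤ bE p q h := by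
  unfold bE bJ
  apply mul_le_mul_of_nonneg_left _ (by positivity)
  apply intervalIntegral.integral_mono_on zero_le_one (bJ_int p q g hg) (bJ_int p q h hh)
  intro x hx
  have : 0 ≤ 1 - x := by linarith [hx.2]
  have h0 : 0 ≤ x := hx.1
  have := hgh x hx.1 hx.2
  gcongr

lemma bE_stein (p q j : ℕ) (m : ℝ) (hm : m = ((p:ℝ) + 1) / ((p:ℝ) + q + 2)) :
    ((p:ℝ) + q + 2) * bE p q (fun x => (x - m) ^ (j + 2))
      = ((j:ℝ) + 1) * bE p q (fun x => (x - m) ^ j * (x * (1 - x))) := by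
  have hm' : ((p:ℝ) + q + 2) * m = p + 1 := by rw [hm]; field_simp
  have h : ∫ x in (0:ℝ)..1, (((j:ℝ) + 1) * ((x - m) ^ j * (x * (1 - x)) * x ^ p * (1 - x) ^ q)
      - ((p:ℝ) + q + 2) * ((x - m) ^ (j + 2) * x ^ p * (1 - x) ^ q))
      = (1 - m) ^ (j + 1) * ((1:ℝ) ^ (p + 1) * (1 - 1) ^ (q + 1))
        - (0 - m) ^ (j + 1) * ((0:ℝ) ^ (p + 1) * (1 - 0) ^ (q + 1)) := by
    apply intervalIntegral.integral_eq_sub_of_hasDerivAt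
      (f := fun x : ℝ => (x - m) ^ (j + 1) * (x ^ (p + 1) * (1 - x) ^ (q + 1)))
    · intro x _
      have h0 := ((hasDerivAt_id x).sub_const m).pow (j + 1)
      have h1 := (hasDerivAt_id x).pow (p + 1)
      have h2 := ((hasDerivAt_id x).const_sub 1).pow (q + 1)
      have h3 := h0.mul (h1.mul h2)
      refine h3.congr_deriv ?_
      simp only [Pi.mul_apply, Pi.pow_apply, id, Nat.add_sub_cancel]
      push_cast
      have hp : (p:ℝ) = ((p:ℝ) + q + 2) * m - 1 := by linarith
      have : ((p:ℝ) + 1) * (1 - x) - (q + 1) * x = - (((p:ℝ) + q + 2) * (x - m)) := by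
        linear_combination (-1 : ℝ) * hm'
      linear_combination ((x - m) ^ (j + 1) * x ^ p * (1 - x) ^ q) * this
    · apply Continuous.intervalIntegrable
      fun_prop
  rw [intervalIntegral.integral_sub (by apply Continuous.intervalIntegrable; fun_prop)
    (by apply Continuous.intervalIntegrable; fun_prop),
    intervalIntegral.integral_const_mul, intervalIntegral.integral_const_mul] at h
  unfold bE bJ
  simp only [sub_self, ne_eq, Nat.add_eq_zero_iff, one_ne_zero, and_false, not_false_eq_true, zero_pow, mul_zero, zero_mul] at h
  linear_combination (-((p:ℝ) + 1) * ((p + q + 1).choose (p + 1) : ℝ)) * h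

lemma bE_mean (p q : ℕ) (m : ℝ) (hm : m = ((p:ℝ) + 1) / ((p:ℝ) + q + 2)) :
    bE p q (fun x => x - m) = 0 := by
  have hm' : ((p:ℝ) + q + 2) * m = p + 1 := by rw [hm]; field_simp
  have h : ∫ x in (0:ℝ)..1, (((p:ℝ) + q + 2) * ((x - m) * x ^ p * (1 - x) ^ q))
      = -((1:ℝ) ^ (p + 1) * (1 - 1) ^ (q + 1))
        - -((0:ℝ) ^ (p + 1) * (1 - 0) ^ (q + 1)) := by
    apply intervalIntegral.integral_eq_sub_of_hasDerivAt
      (f := fun x : ℝ => -(x ^ (p + 1) * (1 - x) ^ (q + 1)))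
    · intro x _
      have h1 := (hasDerivAt_id x).pow (p + 1)
      have h2 := ((hasDerivAt_id x).const_sub 1).pow (q + 1)
      have h3 := (h1.mul h2).neg
      refine h3.congr_deriv ?_
      simp only [Pi.mul_apply, Pi.pow_apply, id, Nat.add_sub_cancel]
      push_cast
      have : ((p:ℝ) + 1) * (1 - x) - (q + 1) * x = - (((p:ℝ) + q + 2) * (x - m)) := by
        linear_combination (-1 : ℝ) * hm'
      linear_combination (-(x ^ p * (1 - x) ^ q)) * this
    · apply Continuous.intervalIntegrable
      fun_prop
  rw [intervalIntegral.integral_const_mul] at h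
  have h0 : ((p:ℝ) + q + 2) ≠ 0 := by positivity
  simp [h0] at h
  unfold bE bJ
  rw [h]; simp

/-- exact variance -/
lemma bE_var (p q : ℕ) (m : ℝ) (hm : m = ((p:ℝ) + 1) / ((p:ℝ) + q + 2)) :
    ((p:ℝ) + q + 3) * bE p q (fun x => (x - m) ^ 2) = m * (1 - m) := by
  have h := bE_stein p q 0 m hm
  have e : (fun x : ℝ => (x - m) ^ 0 * (x * (1 - x)))
    = fun x => (m * (1 - m) + (1 - 2 * m) * (x - m)) + (-1) * (x - m) ^ 2 := by
    ext x; ring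
  rw [e, bE_add _ _ _ _ (by fun_prop) (by fun_prop), bE_add _ _ _ _ (by fun_prop) (by fun_prop),
    bE_const, bE_smul, bE_smul, bE_mean p q m hm] at h
  simp at h
  linarith

lemma bE_step (p q k : ℕ) (m : ℝ) (hm : m = ((p:ℝ) + 1) / ((p:ℝ) + q + 2)) :
    ((p:ℝ) + q + 1) * bE p q (fun x => (x - m) ^ (2 * k + 2))
      ≤ (2 * (k:ℝ) + 1) / 4 * bE p q (fun x => (x - m) ^ (2 * k)) := by
  have h := bE_stein p q (2 * k) m hm
  have h0 : 0 ≤ bE p q (fun x => (x - m) ^ (2 * k + 2)) := by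
    have := bE_mono p q (fun _ => 0) (fun x => (x - m) ^ (2 * k + 2)) (by fun_prop) (by fun_prop)
      (fun x _ _ => by
        have e : (x - m) ^ (2 * k + 2) = ((x - m) ^ (k + 1)) ^ 2 := by ring
        simp only [e]; positivity)
    rwa [bE_const] at this
  have h1 : bE p q (fun x => (x - m) ^ (2 * k) * (x * (1 - x)))
      ≤ bE p q (fun x => 1 / 4 * (x - m) ^ (2 * k)) := by
    apply bE_mono _ _ _ _ (by fun_prop) (by fun_prop)
    intro x _ _
    have : x * (1 - x) ≤ 1 / 4 := by nlinarith [sq_nonneg (x - 1 / 2)]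
    have h2 : 0 ≤ (x - m) ^ (2 * k) := by rw [pow_mul]; positivity
    nlinarith
  rw [bE_smul] at h1
  push_cast at h
  have : (2 * (k:ℝ) + 1) * bE p q (fun x => (x - m) ^ (2 * k) * (x * (1 - x))) ≤
    (2 * (k:ℝ) + 1) * (1 / 4 * bE p q (fun x => (x - m) ^ (2 * k))) := by gcongr
  nlinarith

lemma bE_even (k : ℕ) : ∃ D : ℝ, 0 ≤ D ∧ ∀ p q : ℕ,
    ((p:ℝ) + q + 1) ^ k *
    bE p q (fun x => (x - ((p:ℝ) + 1) / ((p:ℝ) + q + 2)) ^ (2 * k)) ≤ D := by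
  induction k with
  | zero =>
    refine ⟨1, zero_le_one, fun p q => ?_⟩
    simp [bE_one]
  | succ k ih =>
    obtain ⟨D, hD, h⟩ := ih
    refine ⟨(2 * (k:ℝ) + 1) / 4 * D, by positivity, fun p q => ?_⟩
    have h1 := bE_step p q k _ rfl
    have h2 := h p q
    rw [pow_succ, mul_assoc]
    calc _ ≤ ((p:ℝ) + q + 1) ^ k * ((2 * (k:ℝ) + 1) / 4 *
          bE p q (fun x => (x - ((p:ℝ) + 1) / ((p:ℝ) + q + 2)) ^ (2 * k))) := by
            apply mul_le_mul_of_nonneg_left h1 (by positivity)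
      _ = (2 * (k:ℝ) + 1) / 4 * (((p:ℝ) + q + 1) ^ k * 
          bE p q (fun x => (x - ((p:ℝ) + 1) / ((p:ℝ) + q + 2)) ^ (2 * k))) := by ring
      _ ≤ _ := by gcongr

/-- upper bound on one term, with `s = √n` -/
lemma bE_upper (a : ℕ) : ∃ D : ℝ, 0 ≤ D ∧ ∀ (p q : ℕ) (b s : ℝ), 0 < s →
    s ^ 2 = (p:ℝ) + q + 1 → |((p:ℝ) + 1) / ((p:ℝ) + q + 2) - b| ≤ 1 / s →
    s ^ a * bE p q (fun x => |x - b| ^ a) ≤ D := by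
  obtain ⟨D, hD, h⟩ := bE_even a
  refine ⟨2 ^ (a - 1) * (1 + (1 + D)), by positivity, fun p q b s hs hs2 hb => ?_⟩
  set m := ((p:ℝ) + 1) / ((p:ℝ) + q + 2) with hm
  have h1 : bE p q (fun x => s ^ a * |x - b| ^ a) ≤
      bE p q (fun x => 2 ^ (a - 1) * (2 + (s ^ 2) ^ a * (x - m) ^ (2 * a))) := by
    apply bE_mono _ _ _ _ (by fun_prop) (by fun_prop)
    intro x _ _
    have e1 : s * |x - b| ≤ s * |x - m| + 1 := by
      have : |x - b| ≤ |x - m| + |m - b| := abs_sub_le _ _ _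
      have h3 : s * |m - b| ≤ 1 := by
        calc _ ≤ s * (1 / s) := by gcongr
          _ = 1 := by field_simp
      nlinarith
    have e2 : (s * |x - m| + 1) ^ a ≤ 2 ^ (a - 1) * ((s * |x - m|) ^ a + 1 ^ a) :=
      add_pow_le (by positivity) (by positivity) a
    have e3 : (s * |x - m|) ^ a ≤ 1 + (s ^ 2) ^ a * (x - m) ^ (2 * a) := by
      have : (s ^ 2) ^ a * (x - m) ^ (2 * a) = ((s * |x - m|) ^ a) ^ 2 := by
        rw [pow_mul (x - m), ← sq_abs (x - m)]; ring
      rw [this]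
      nlinarith [sq_nonneg ((s * |x - m|) ^ a - 1), sq_nonneg ((s * |x - m|) ^ a)]
    rw [← mul_pow]
    calc _ ≤ (s * |x - m| + 1) ^ a := by gcongr
      _ ≤ _ := e2
      _ ≤ _ := by
        apply mul_le_mul_of_nonneg_left _ (by positivity)
        rw [one_pow]; linarith
  rw [bE_smul, bE_smul, bE_add _ _ _ _ (by fun_prop) (by fun_prop), bE_const, bE_smul] at h1
  have h2 := h p q
  rw [← hs2] at h2
  refine h1.trans ?_
  apply mul_le_mul_of_nonneg_left _ (by positivity)
  linarith

/-- lower bound for the first absolute moment -/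
lemma bE_lower_one (p q : ℕ) (b s : ℝ) (hs : 0 < s) (hs2 : s ^ 2 = (p:ℝ) + q + 1) :
    s / 8 * (((p:ℝ) + 1) * (q + 1) / (((p:ℝ) + q + 2) ^ 2 * ((p:ℝ) + q + 3)))
      ≤ bE p q (fun x => |x - b|) := by
  set m := ((p:ℝ) + 1) / ((p:ℝ) + q + 2) with hm
  have hv := bE_var p q m hm
  have h4 := bE_step p q 1 m hm
  norm_num at h4
  have hM2 : 0 ≤ bE p q (fun x => (x - m) ^ 2) := by
    have := bE_mono p q (fun _ => 0) (fun x => (x - m) ^ 2) (by fun_prop) (by fun_prop)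
      (fun x _ _ => by positivity)
    rwa [bE_const] at this
  have hv' : bE p q (fun x => (x - m) ^ 2)
      = ((p:ℝ) + 1) * (q + 1) / (((p:ℝ) + q + 2) ^ 2 * ((p:ℝ) + q + 3)) := by
    have : m * (1 - m) = ((p:ℝ) + 1) * (q + 1) / (((p:ℝ) + q + 2) ^ 2) := by
      rw [hm]; field_simp; ring
    rw [this] at hv
    field_simp
    field_simp at hv
    linarith
  rw [← hv']
  have hb1 : |m - b| ≤ bE p q (fun x => |x - b|) := by
    have e : bE p q (fun x => x - b) = m - b := by
      have : (fun x : ℝ => x - b) = fun x => (x - m) + (m - b) := by ext x; ring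
      rw [this, bE_add _ _ _ _ (by fun_prop) (by fun_prop), bE_mean p q m hm, bE_const, zero_add]
    apply abs_le.2
    constructor
    · have := bE_mono p q (fun x => (-1) * |x - b|) (fun x => x - b) (by fun_prop) (by fun_prop)
        (fun x _ _ => by linarith [neg_abs_le (x - b)])
      rw [bE_smul, e] at this
      linarith
    · rw [← e]
      exact bE_mono p q _ _ (by fun_prop) (by fun_prop) (fun x _ _ => le_abs_self _)
  have hb2 : bE p q (fun x => |x - m|) ≤ bE p q (fun x => |x - b|) + |m - b| := by
    have := bE_mono p q (fun x => |x - m|) (fun x => |x - b| + |m - b|) (by fun_prop) (by fun_prop)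
      (fun x _ _ => by rw [abs_sub_comm m b]; exact abs_sub_le _ _ _)
    rwa [bE_add _ _ _ _ (by fun_prop) (by fun_prop), bE_const] at this
  have h5 : bE p q (fun x => s * (x - m) ^ 2) ≤
      bE p q (fun x => 2 * |x - m| + (s ^ 2 * s / 4) * (x - m) ^ 4) := by
    apply bE_mono _ _ _ _ (by fun_prop) (by fun_prop)
    intro x _ _
    have e1 : (x - m) ^ 2 = |x - m| ^ 2 := (sq_abs _).symm
    have e2 : (x - m) ^ 4 = |x - m| ^ 4 := by
      rw [show 4 = 2 * 2 from rfl, pow_mul, pow_mul, sq_abs]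
    rw [e1, e2]
    have hy : 0 ≤ |x - m| := abs_nonneg _
    generalize |x - m| = y at hy
    rcases le_total (s * y) 2 with hc | hc
    · have h7 : 0 ≤ (s ^ 2 * s / 4) * y ^ 4 := by positivity
      nlinarith
    · have h7 : 0 ≤ s * y ^ 2 * ((s * y) ^ 2 / 4 - 1) := by
        apply mul_nonneg (by positivity)
        nlinarith
      nlinarith
  rw [bE_smul, bE_add _ _ _ _ (by fun_prop) (by fun_prop), bE_smul, bE_smul] at h5
  rw [← hs2] at h4
  have h6 : s * (s ^ 2 * bE p q (fun x => (x - m) ^ 4)) ≤ s * (3 / 4 * bE p q (fun x => (x - m) ^ 2)) := by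
    gcongr
  have : 0 ≤ s * bE p q (fun x => (x - m) ^ 2) := by positivity
  nlinarith

lemma sum_var (n : ℕ) : ∑ i ∈ Finset.Icc 1 n, (i:ℝ) * ((n:ℝ) + 1 - i) = n * (n + 1) * (n + 2) / 6 := by
  have h : ∀ (N : ℝ) (n : ℕ), ∑ i ∈ Finset.Icc 1 n, (i:ℝ) * (N + 1 - i)
      = (N + 1) * (n * (n + 1) / 2) - n * (n + 1) * (2 * n + 1) / 6 := by
    intro N n
    induction n with
    | zero => simp
    | succ n ih =>
      rw [Finset.sum_Icc_succ_top (by omega), ih]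
      push_cast
      ring
  rw [h]; ring

lemma expCost_eq (a n : ℕ) (b : ℕ → ℝ) :
    expCost a n b = ∑ i ∈ Finset.Icc 1 n, bE (i - 1) (n - i) (fun x => |x - b i| ^ a) := by
  unfold expCost
  apply Finset.sum_congr rfl
  intro i hi
  obtain ⟨h1, h2⟩ := Finset.mem_Icc.1 hi
  obtain ⟨p, rfl⟩ : ∃ p, i = p + 1 := ⟨i - 1, by omega⟩
  obtain ⟨q, rfl⟩ : ∃ q, n = p + 1 + q := ⟨n - (p + 1), by omega⟩
  unfold bE bJ
  simp only [Nat.add_sub_cancel, Nat.add_sub_cancel_left]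
  rw [show p + q + 1 = p + 1 + q by ring]
  push_cast
  rfl

lemma cost_lower (a n : ℕ) (hn : 1 ≤ n) (b : ℕ → ℝ) :
    (n:ℝ) * (1 / (96 * √(n:ℝ))) ^ a ≤ expCost a n b := by
  rw [expCost_eq]
  have hn' : (1:ℝ) ≤ n := by exact_mod_cast hn
  set s := √(n:ℝ) with hs
  have hs0 : 0 < s := Real.sqrt_pos.2 (by linarith)
  have hs2 : s ^ 2 = n := Real.sq_sqrt (by linarith)
  set T := 1 / (96 * s) with hT
  have hT0 : 0 < T := by positivity
  have key : ∀ i ∈ Finset.Icc 1 n,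
      T ^ a * (1 - a + (a / T) * (s / 8 / (((n:ℝ) + 1) ^ 2 * (n + 2)) * ((i:ℝ) * ((n:ℝ) + 1 - i))))
      ≤ bE (i - 1) (n - i) (fun x => |x - b i| ^ a) := by
    intro i hi
    obtain ⟨h1, h2⟩ := Finset.mem_Icc.1 hi
    obtain ⟨p, rfl⟩ : ∃ p, i = p + 1 := ⟨i - 1, by omega⟩
    obtain ⟨q, hq⟩ : ∃ q, n = p + 1 + q := ⟨n - (p + 1), by omega⟩
    have hnr : (n:ℝ) = p + q + 1 := by rw [hq]; push_cast; ring
    have e1 : n - (p + 1) = q := by omega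
    simp only [Nat.add_sub_cancel, e1]
    have hl := bE_lower_one p q (b (p + 1)) s hs0 (hs2.trans hnr)
    have hb := bE_mono p q (fun x => T ^ a * (1 - a + (a / T) * |x - b (p + 1)|))
      (fun x => |x - b (p + 1)| ^ a) (by fun_prop) (by fun_prop) (by
        intro x _ _
        have := one_add_mul_sub_le_pow (a := |x - b (p + 1)| / T) 
          (by have : 0 ≤ |x - b (p + 1)| / T := by positivity
              linarith) a
        calc T ^ a * (1 - a + (a / T) * |x - b (p + 1)|)
            = T ^ a * (1 + a * (|x - b (p + 1)| / T - 1)) := by ring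
          _ ≤ T ^ a * (|x - b (p + 1)| / T) ^ a := by gcongr
          _ = _ := by rw [← mul_pow]; congr 1; field_simp)
    rw [bE_smul, bE_add _ _ _ _ (by fun_prop) (by fun_prop), bE_const, bE_smul] at hb
    refine le_trans ?_ hb
    gcongr
    refine le_trans (le_of_eq ?_) hl
    rw [hnr]
    push_cast
    have : (p:ℝ) + q + 1 + 1 = p + q + 2 := by ring
    rw [this, show (p:ℝ) + q + 1 + 2 = p + q + 3 by ring]
    ring
  refine le_trans ?_ (Finset.sum_le_sum key)
  rw [← Finset.mul_sum, Finset.sum_add_distrib, ← Finset.mul_sum, ← Finset.mul_sum, sum_var]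
  simp only [Finset.sum_const, Nat.card_Icc, Nat.add_sub_cancel, nsmul_eq_mul]
  rw [mul_comm]
  gcongr
  have h1 : (n:ℝ) * T ≤ s / 8 / (((n:ℝ) + 1) ^ 2 * (n + 2)) * (n * (n + 1) * (n + 2) / 6) := by
    have : s / 8 / (((n:ℝ) + 1) ^ 2 * (n + 2)) * (n * (n + 1) * (n + 2) / 6)
      = s * n / (48 * (n + 1)) := by field_simp; norm_num
    rw [this, hT, mul_one_div, div_le_div_iff₀ (by positivity) (by positivity)]
    nlinarith
  have h2 : (a / T) * (n * T) ≤ (a / T) * (s / 8 / (((n:ℝ) + 1) ^ 2 * (n + 2)) * (n * (n + 1) * (n + 2) / 6)) := by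
    gcongr
  have h3 : (a / T) * (n * T) = a * n := by field_simp
  linarith

lemma cost_upper (a : ℕ) : ∃ D : ℝ, 0 ≤ D ∧ ∀ n : ℕ, 1 ≤ n →
    expCost a n (fun i => (2 * (i:ℝ) - 1) / (2 * n)) ≤ n * (D / √(n:ℝ) ^ a) := by
  obtain ⟨D, hD, h⟩ := bE_upper a
  refine ⟨D, hD, fun n hn => ?_⟩
  rw [expCost_eq]
  have hn' : (1:ℝ) ≤ n := by exact_mod_cast hn
  set s := √(n:ℝ) with hs
  have hs0 : 0 < s := Real.sqrt_pos.2 (by linarith)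
  have hs2 : s ^ 2 = n := Real.sq_sqrt (by linarith)
  have hs1 : 1 ≤ s := by nlinarith
  refine (Finset.sum_le_card_nsmul _ _ (D / s ^ a) ?_).trans ?_
  · intro i hi
    obtain ⟨h1, h2⟩ := Finset.mem_Icc.1 hi
    obtain ⟨p, rfl⟩ : ∃ p, i = p + 1 := ⟨i - 1, by omega⟩
    obtain ⟨q, hq⟩ : ∃ q, n = p + 1 + q := ⟨n - (p + 1), by omega⟩
    have hnr : (n:ℝ) = p + q + 1 := by rw [hq]; push_cast; ring
    have e1 : n - (p + 1) = q := by omega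
    simp only [Nat.add_sub_cancel, e1]
    rw [le_div_iff₀' (by positivity)]
    apply h p q _ s hs0 (hs2.trans hnr)
    have : ((p:ℝ) + 1) / (p + q + 2) - (2 * ((p + 1 : ℕ) : ℝ) - 1) / (2 * n)
        = ((q:ℝ) - p) / (2 * n * (n + 1)) := by
      rw [hnr]; push_cast; field_simp; ring
    rw [this, abs_div, abs_of_pos (by positivity : (0:ℝ) < 2 * n * (n + 1)),
      div_le_div_iff₀ (by positivity) hs0, one_mul]
    have h3 : |(q:ℝ) - p| ≤ n := by
      rw [abs_le]; constructor <;> [skip; skip] <;>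
      linarith [(Nat.cast_nonneg p : (0:ℝ) ≤ p), (Nat.cast_nonneg q : (0:ℝ) ≤ q)]
    have h4 : s ≤ n := by nlinarith
    calc _ ≤ (n:ℝ) * n := by gcongr
      _ ≤ _ := by nlinarith
  · simp

lemma covers_mid (n : ℕ) (hn : 1 ≤ n) (e : ℝ) (he : 0 < e) :
    Covers n (1 / (2 * n) + e / 2) (fun i => (2 * (i:ℝ) - 1) / (2 * n)) := by
  have hn' : (1:ℝ) ≤ n := by exact_mod_cast hn
  have hn0 : (n:ℝ) ≠ 0 := by linarith
  refine ⟨?_, ?_, ?_, ?_, ?_, ?_⟩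
  · norm_num
  · rw [div_le_one (by positivity)]; linarith
  · intro i _
    push_cast
    gcongr
    linarith
  · norm_num; linarith
  · have : 1 - (2 * (n:ℝ) - 1) / (2 * n) = 1 / (2 * n) := by field_simp; ring
    simp only [this]; linarith
  · intro i _
    have : (2 * ((i + 1 : ℕ):ℝ) - 1) / (2 * n) - (2 * (i:ℝ) - 1) / (2 * n) = 2 * (1 / (2 * n)) := by
      push_cast; field_simp; ring
    simp only [this]; linarith

lemma rpow_id (a n : ℕ) (hn : 1 ≤ n) :
    (n : ℝ) ^ ((1 : ℝ) - (a : ℝ) / 2) = n / √(n:ℝ) ^ a := by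
  have hn' : (0:ℝ) < n := by exact_mod_cast hn
  rw [Real.rpow_sub hn', Real.rpow_one, Real.sqrt_eq_rpow, ← Real.rpow_natCast, ← Real.rpow_mul hn'.le]
  congr 2; ring

theorem stmt4 (a : ℕ) (ha : 0 < a) (f : ℕ → ℝ) (hf : ∀ n, 0 < f n)
    (hfo : Filter.Tendsto (fun n : ℕ => (n : ℝ) ^ ((3 : ℝ) / 2) * f n)
      Filter.atTop (nhds 0)) :
    ∃ c₁ c₂ : ℝ, 0 < c₁ ∧ c₁ ≤ c₂ ∧ ∃ N : ℕ, ∀ n : ℕ, N ≤ n →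
      c₁ * (n : ℝ) ^ ((1 : ℝ) - (a : ℝ) / 2)
          ≤ sInf {S : ℝ | ∃ b : ℕ → ℝ,
              Covers n (1 / (2 * n) + f n / 2) b ∧ S = expCost a n b} ∧
      sInf {S : ℝ | ∃ b : ℕ → ℝ,
              Covers n (1 / (2 * n) + f n / 2) b ∧ S = expCost a n b}
          ≤ c₂ * (n : ℝ) ^ ((1 : ℝ) - (a : ℝ) / 2) := by
  obtain ⟨D, hD, hup⟩ := cost_upper a
  refine ⟨(1 / 96) ^ a, (1 / 96) ^ a + D, by positivity, by linarith, 1, fun n hn => ?_⟩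
  have hlow : ∀ S ∈ {S : ℝ | ∃ b : ℕ → ℝ,
      Covers n (1 / (2 * n) + f n / 2) b ∧ S = expCost a n b},
      (1 / 96) ^ a * (n : ℝ) ^ ((1 : ℝ) - (a : ℝ) / 2) ≤ S := by
    rintro S ⟨b, -, rfl⟩
    refine le_trans (le_of_eq ?_) (cost_lower a n hn b)
    rw [rpow_id a n hn, ← div_div, div_pow (1 / 96 : ℝ)]
    ring
  have hmem : expCost a n (fun i => (2 * (i:ℝ) - 1) / (2 * n)) ∈ {S : ℝ | ∃ b : ℕ → ℝ,
      Covers n (1 / (2 * n) + f n / 2) b ∧ S = expCost a n b} :=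
    ⟨_, covers_mid n hn (f n) (hf n), rfl⟩
  refine ⟨le_csInf ⟨_, hmem⟩ hlow, (csInf_le ⟨_, hlow⟩ hmem).trans ((hup n hn).trans ?_)⟩
  rw [rpow_id a n hn, add_mul]
  have : 0 ≤ (1 / 96 : ℝ) ^ a * (n / √(n:ℝ) ^ a) := by positivity
  have e : (n:ℝ) * (D / √(n:ℝ) ^ a) = D * (n / √(n:ℝ) ^ a) := by ring
  linarith
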